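/- Let X be a Banach space with an unconditional basis (e_i) and let x = Σ_i a_i e_i ∈ X have all coordinates a_i strictly positive. Then the order interval K = [−x, x] = { y = Σ_i b_i e_i : |b_i| ≤ a_i for all i } is a compact convex subset of X containing 0 whose closed linear span equals X, and K is a Lipschitz retract of X (via the truncation map y ↦ Σ_i max(−a_i, min(b_i, a_i)) e_i). -/

import Mathlib

open Filter Topology Metric Set

noncomputable section

theorem aux_conv {X : Type*} [NormedAddCommGroup X] [NormedSpace ℝ X] (v : ℕ → X)
    (t : ℕ → ℝ) (h0 : ∀ i, 0 ≤ t i) (h1 : ∀ i, t i ≤ 1) (M : ℝ) (s : Finset ℕ) :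
    ∀ w : X, (∀ u ⊆ s, ‖w + ∑ i ∈ u, v i‖ ≤ M) → ‖w + ∑ i ∈ s, t i • v i‖ ≤ M := by
  classical
  induction s using Finset.induction_on with
  | empty =>
    intro w h
    simpa using h ∅ (by simp)
  | insert j s hj ih =>
    intro w h
    have e1 := ih w (fun u hu => h u (hu.trans (Finset.subset_insert _ _)))
    have e2 := ih (w + v j) (fun u hu => by
      have := h (insert j u) (Finset.insert_subset_insert _ hu)
      rw [Finset.sum_insert (fun hh => hj (hu hh))] at this
      rwa [add_assoc])
    rw [Finset.sum_insert hj]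
    have : w + (t j • v j + ∑ i ∈ s, t i • v i) =
        (1 - t j) • (w + ∑ i ∈ s, t i • v i) + t j • (w + v j + ∑ i ∈ s, t i • v i) := by
      module
    rw [this]
    refine (norm_add_le _ _).trans ?_
    rw [norm_smul, norm_smul, Real.norm_of_nonneg (h0 j),
      Real.norm_of_nonneg (sub_nonneg.2 (h1 j))]
    nlinarith [h0 j, h1 j]

theorem aux_two {X : Type*} [NormedAddCommGroup X] [NormedSpace ℝ X] (e : ℕ → X)
    (b c : ℕ → ℝ) (h : ∀ i, |c i| ≤ |b i|) (M : ℝ) (s : Finset ℕ)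
    (hM : ∀ u ⊆ s, ‖∑ i ∈ u, b i • e i‖ ≤ M) : ‖∑ i ∈ s, c i • e i‖ ≤ 2 * M := by
  have key : ∀ i, |c i / b i| ≤ 1 := fun i => by
    rw [abs_div]
    exact div_le_one_of_le₀ (h i) (abs_nonneg _)
  have hc : ∀ i, c i = c i / b i * b i := fun i => by
    by_cases hb : b i = 0
    · have := h i
      rw [hb, abs_zero] at this
      have : c i = 0 := abs_nonpos_iff.1 this
      simp [this]
    · field_simp
  have p := aux_conv (fun i => b i • e i) (fun i => max (c i / b i) 0)
    (fun i => le_max_right _ _) (fun i => max_le ((abs_le.1 (key i)).2) zero_le_one) M s 0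
    (by simpa using hM)
  have q := aux_conv (fun i => b i • e i) (fun i => max (-(c i / b i)) 0)
    (fun i => le_max_right _ _) (fun i => max_le (by linarith [(abs_le.1 (key i)).1])
      zero_le_one) M s 0
    (by simpa using hM)
  rw [zero_add] at p q
  have : ∑ i ∈ s, c i • e i = ∑ i ∈ s, max (c i / b i) 0 • b i • e i
      - ∑ i ∈ s, max (-(c i / b i)) 0 • b i • e i := by
    rw [← Finset.sum_sub_distrib]
    refine Finset.sum_congr rfl fun i _ => ?_
    rw [← sub_smul, smul_smul]
    congr 1
    have : max (c i / b i) 0 - max (-(c i / b i)) 0 = c i / b i := by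
      rcases le_total 0 (c i / b i) with hh | hh
      · rw [max_eq_left hh, max_eq_right (by linarith)]; ring
      · rw [max_eq_right hh, max_eq_left (by linarith)]; ring
    rw [this]; exact hc i
  rw [this]
  refine (norm_sub_le _ _).trans ?_
  linarith

theorem aux_summable {X : Type*} [NormedAddCommGroup X] [NormedSpace ℝ X] [CompleteSpace X]
    (e : ℕ → X)
    (b c : ℕ → ℝ) (h : ∀ i, |c i| ≤ |b i|) (hb : Summable (fun i => b i • e i)) :
    Summable (fun i => c i • e i) := by
  rw [summable_iff_vanishing_norm] at hb ⊢
  intro ε hε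
  obtain ⟨s, hs⟩ := hb (ε / 4) (by positivity)
  refine ⟨s, fun t ht => ?_⟩
  have := aux_two e b c h (ε / 4) t (fun u hu => (hs u (ht.mono_left hu)).le)
  linarith

theorem aux_bdd {X : Type*} [NormedAddCommGroup X] (v : ℕ → X) (y : X) (hv : HasSum v y) :
    ∃ C, ∀ s : Finset ℕ, ‖∑ i ∈ s, v i‖ ≤ C := by
  classical
  have := (Metric.tendsto_atTop.1 hv) 1 one_pos
  obtain ⟨s0, h0⟩ := this
  refine ⟨1 + ‖y‖ + ∑ i ∈ s0, ‖v i‖, fun s => ?_⟩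
  have h1 := h0 (s0 ∪ s) Finset.subset_union_left
  have h2 : ∑ i ∈ s0 ∪ s, v i = ∑ i ∈ s0 \ s, v i + ∑ i ∈ s, v i := by
    rw [← Finset.sum_union Finset.sdiff_disjoint, Finset.sdiff_union_self_eq_union]
  have h3 : ‖∑ i ∈ s0 \ s, v i‖ ≤ ∑ i ∈ s0, ‖v i‖ :=
    (norm_sum_le _ _).trans (Finset.sum_le_sum_of_subset_of_nonneg Finset.sdiff_subset
      (fun _ _ _ => norm_nonneg _))
  have h4 : ∑ i ∈ s, v i = (∑ i ∈ s0 ∪ s, v i - y) + y - ∑ i ∈ s0 \ s, v i := by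
    rw [h2]; abel
  rw [dist_eq_norm] at h1
  rw [h4]
  refine (norm_sub_le _ _).trans ?_
  have := norm_add_le (∑ i ∈ s0 ∪ s, v i - y) y
  linarith

theorem aux_unif {X : Type*} [NormedAddCommGroup X] [NormedSpace ℝ X]
    [CompleteSpace X] (e : ℕ → X)
    (hbasis : ∀ y : X, ∃! b : ℕ → ℝ, HasSum (fun i => b i • e i) y) :
    ∃ C : ℝ, 0 ≤ C ∧ ∀ (y : X) (b : ℕ → ℝ), HasSum (fun i => b i • e i) y →
      ∀ s : Finset ℕ, ‖∑ i ∈ s, b i • e i‖ ≤ C * ‖y‖ := by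
  choose B hB hU using hbasis
  simp only at hB hU
  have hadd : ∀ y z, B (y + z) = B y + B z := fun y z => by
    refine (hU (y + z) _ ?_).symm
    simpa [add_smul] using (hB y).add (hB z)
  have hsmul : ∀ (k : ℝ) z, B (k • z) = k • B z := fun k z => by
    refine (hU (k • z) _ ?_).symm
    simpa [mul_smul] using (hB z).const_smul k
  letI : TopologicalSpace (Finset ℕ) := ⊥
  haveI : DiscreteTopology (Finset ℕ) := ⟨rfl⟩
  choose C hC using fun y => aux_bdd _ y (hB y)
  let P : X →ₗ[ℝ] BoundedContinuousFunction (Finset ℕ) X :=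
    { toFun := fun y => BoundedContinuousFunction.ofNormedAddCommGroup
        (fun s => ∑ i ∈ s, B y i • e i) continuous_of_discreteTopology (C y) (hC y)
      map_add' := fun y z => by
        ext s
        simp [hadd, add_smul, Finset.sum_add_distrib]
      map_smul' := fun k z => by
        ext s
        simp [hsmul, mul_smul, Finset.smul_sum] }
  have hP : ∀ y s, P y s = ∑ i ∈ s, B y i • e i := fun y s => rfl
  have hcont : Continuous P := by
    refine LinearMap.continuous_of_seq_closed_graph P fun u y F hu hF => ?_
    have hpt : ∀ s, Tendsto (fun n => P (u n) s) atTop (𝓝 (F s)) := fun s =>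
      tendsto_iff_dist_tendsto_zero.2 (squeeze_zero (fun _ => dist_nonneg)
        (fun n => BoundedContinuousFunction.dist_coe_le_dist s)
        (tendsto_iff_dist_tendsto_zero.1 hF))
    have h1 : ∀ i, ∃ k : ℝ, k • e i = F {i} := fun i => by
      rw [← Submodule.mem_span_singleton]
      have hc : IsClosed ((Submodule.span ℝ {e i} : Submodule ℝ X) : Set X) :=
        Submodule.closed_of_finiteDimensional _
      refine hc.mem_of_tendsto (hpt {i}) (Eventually.of_forall fun n => ?_)
      rw [hP, Finset.sum_singleton]
      exact Submodule.smul_mem _ _ (Submodule.mem_span_singleton_self _)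
    choose k hk using h1
    have h2 : ∀ s, F s = ∑ i ∈ s, k i • e i := fun s => by
      refine tendsto_nhds_unique (hpt s) ?_
      simp only [hP]
      refine tendsto_finsetSum _ fun i _ => ?_
      have := hpt {i}
      simpa [hP, hk] using this
    have h3 : HasSum (fun i => k i • e i) y := by
      refine Metric.tendsto_atTop.2 fun ε hε => ?_
      obtain ⟨n, hn1, hn2⟩ := ((Metric.tendsto_nhds.1 hu (ε/3) (by positivity)).and
        (Metric.tendsto_nhds.1 hF (ε/3) (by positivity))).exists
      obtain ⟨s0, hs0⟩ := Metric.tendsto_atTop.1 (hB (u n)) (ε/3) (by positivity)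
      refine ⟨s0, fun s hs => ?_⟩
      have a1 := hs0 s hs
      have a2 : dist (P (u n) s) (F s) ≤ dist (P (u n)) F :=
        BoundedContinuousFunction.dist_coe_le_dist s
      rw [← h2]
      rw [← hP] at a1
      have := dist_triangle4 (F s) (P (u n) s) (u n) y
      rw [dist_comm (F s) (P (u n) s)] at this
      have hn3 : dist (P (u n)) F < ε / 3 := hn2
      linarith
    have h4 := hU y k h3
    ext s
    rw [hP, h2, h4]
  let Q : X →L[ℝ] BoundedContinuousFunction (Finset ℕ) X := ⟨P, hcont⟩
  refine ⟨‖Q‖, norm_nonneg _, fun y b hb s => ?_⟩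
  rw [hU y b hb, ← hP]
  exact ((P y).norm_coe_le_norm s).trans (Q.le_opNorm y)

theorem aux_trunc (a : ℝ) (ha : 0 < a) (b c : ℝ) :
    |max (-a) (min b a)| ≤ a ∧ |max (-a) (min b a)| ≤ |b| ∧
    (|b| ≤ a → max (-a) (min b a) = b) ∧
    |max (-a) (min b a) - max (-a) (min c a)| ≤ |b - c| := by
  refine ⟨?_, ?_, ?_, ?_⟩
  · exact abs_le.2 ⟨le_max_left _ _, max_le (by linarith) (min_le_right _ _)⟩
  · refine abs_le.2 ⟨?_, ?_⟩
    · rcases le_total b a with h | h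
      · rw [min_eq_left h]; exact (neg_abs_le b).trans (le_max_right _ _)
      · rw [min_eq_right h]; exact le_trans (by linarith [abs_nonneg b]) (le_max_right _ _)
    · exact max_le (by linarith [abs_nonneg b]) ((min_le_left _ _).trans (le_abs_self _))
  · intro h
    rw [min_eq_left (abs_le.1 h).2, max_eq_right (abs_le.1 h).1]
  · have h1 := abs_max_sub_max_le_max (-a) (min b a) (-a) (min c a)
    have h2 := abs_min_sub_min_le_max b a c a
    simp only [sub_self, abs_zero] at h1 h2
    rw [max_eq_right (abs_nonneg (min b a - min c a))] at h1
    rw [max_eq_left (abs_nonneg (b - c))] at h2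
    exact h1.trans h2

theorem aux_compact {X : Type*} [NormedAddCommGroup X] [NormedSpace ℝ X]
    [CompleteSpace X] (e : ℕ → X)
    (a : ℕ → ℝ) (ha : ∀ i, 0 < a i) (x : X) (hx : HasSum (fun i => a i • e i) x) :
    IsCompact {y : X | ∃ b : ℕ → ℝ, (∀ i, |b i| ≤ a i) ∧ HasSum (fun i => b i • e i) y} := by
  classical
  have hab : ∀ b : ℕ → ℝ, (∀ i, |b i| ≤ a i) → ∀ i, |b i| ≤ |a i| := fun b hb i =>
    (hb i).trans (le_abs_self _)
  have hs : ∀ b : ℕ → ℝ, (∀ i, |b i| ≤ a i) → Summable (fun i => b i • e i) := fun b hb =>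
    aux_summable e a b (hab b hb) hx.summable
  have hK : IsCompact (Set.pi univ fun i => Icc (-a i) (a i)) :=
    isCompact_univ_pi fun i => isCompact_Icc
  have hmem : ∀ b : ℕ → ℝ, b ∈ (Set.pi univ fun i => Icc (-a i) (a i)) ↔ ∀ i, |b i| ≤ a i := by
    intro b
    simp only [Set.mem_pi, Set.mem_univ, true_imp_iff, Set.mem_Icc, abs_le]
  have hunif : TendstoUniformlyOn (fun (s : Finset ℕ) (b : ℕ → ℝ) => ∑ i ∈ s, b i • e i)
      (fun b => ∑' i, b i • e i) atTop (Set.pi univ fun i => Icc (-a i) (a i)) := by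
    rw [Metric.tendstoUniformlyOn_iff]
    intro ε hε
    obtain ⟨s0, hs0⟩ := summable_iff_vanishing_norm.1 hx.summable (ε / 4) (by positivity)
    filter_upwards [eventually_ge_atTop s0] with s hss b hb
    rw [hmem] at hb
    have hle : dist (∑' i, b i • e i) (∑ i ∈ s, b i • e i) ≤ 2 * (ε / 4) := by
      have ht : Tendsto (fun u => dist (∑ i ∈ u, b i • e i) (∑ i ∈ s, b i • e i)) atTop
          (𝓝 (dist (∑' i, b i • e i) (∑ i ∈ s, b i • e i))) :=
        Tendsto.dist (hs b hb).hasSum tendsto_const_nhds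
      refine le_of_tendsto ht ?_
      filter_upwards [eventually_ge_atTop s] with u hu
      rw [dist_eq_norm, ← Finset.sum_sdiff hu, add_sub_cancel_right]
      refine aux_two e a b (hab b hb) _ _ fun w hw => (hs0 w ?_).le
      exact Finset.disjoint_of_subset_left hw
        (Finset.disjoint_of_subset_right hss Finset.sdiff_disjoint)
    linarith
  have hco := hunif.continuousOn (Frequently.of_forall fun s => by fun_prop)
  convert hK.image_of_continuousOn hco using 1
  ext y
  constructor
  · rintro ⟨b, hb, hy⟩
    exact ⟨b, (hmem b).2 hb, hy.tsum_eq⟩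
  · rintro ⟨b, hb, rfl⟩
    exact ⟨b, (hmem b).1 hb, (hs b ((hmem b).1 hb)).hasSum⟩

/-- If `X` is a Banach space with an unconditional basis `(e i)`
(formalized: every `y : X` has a unique unconditionally convergent expansion
`y = ∑ b i • e i`) and `x = ∑ a i • e i` has all coordinates `a i > 0`, then the order
interval `K = [-x, x] = {∑ b i • e i : |b i| ≤ a i}` is a compact convex subset of `X`
containing `0` whose closed linear span is `X`, and `K` is a Lipschitz retract of `X`
via the truncation map `∑ b i • e i ↦ ∑ (max (-a i) (min (b i) (a i))) • e i`. -/
theorem free_spaces_stmt18 {X : Type*} [NormedAddCommGroup X] [NormedSpace ℝ X]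
    [CompleteSpace X] (e : ℕ → X)
    (hbasis : ∀ y : X, ∃! b : ℕ → ℝ, HasSum (fun i => b i • e i) y)
    (a : ℕ → ℝ) (ha : ∀ i, 0 < a i) (x : X) (hx : HasSum (fun i => a i • e i) x) :
    IsCompact {y : X | ∃ b : ℕ → ℝ, (∀ i, |b i| ≤ a i) ∧ HasSum (fun i => b i • e i) y} ∧
    Convex ℝ {y : X | ∃ b : ℕ → ℝ, (∀ i, |b i| ≤ a i) ∧ HasSum (fun i => b i • e i) y} ∧
    (0 : X) ∈ {y : X | ∃ b : ℕ → ℝ, (∀ i, |b i| ≤ a i) ∧ HasSum (fun i => b i • e i) y} ∧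
    (Submodule.span ℝ
        {y : X | ∃ b : ℕ → ℝ, (∀ i, |b i| ≤ a i) ∧
          HasSum (fun i => b i • e i) y}).topologicalClosure = ⊤ ∧
    ∃ (c : NNReal) (r : X → X), LipschitzWith c r ∧
      (∀ y : X, r y ∈ {y : X | ∃ b : ℕ → ℝ, (∀ i, |b i| ≤ a i) ∧
        HasSum (fun i => b i • e i) y}) ∧
      (∀ y ∈ {y : X | ∃ b : ℕ → ℝ, (∀ i, |b i| ≤ a i) ∧
        HasSum (fun i => b i • e i) y}, r y = y) ∧
      ∀ (y : X) (b : ℕ → ℝ), HasSum (fun i => b i • e i) y →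
        HasSum (fun i => (max (-(a i)) (min (b i) (a i))) • e i) (r y) := by
  classical
  obtain ⟨C, hC0, hC⟩ := aux_unif e hbasis
  refine ⟨aux_compact e a ha x hx, ?_, ?_, ?_, ?_⟩
  · rintro y ⟨b, hb, hy⟩ z ⟨c, hc, hz⟩ p q hp hq hpq
    refine ⟨fun i => p * b i + q * c i, fun i => ?_, ?_⟩
    · refine (abs_add_le _ _).trans ?_
      rw [abs_mul, abs_mul, abs_of_nonneg hp, abs_of_nonneg hq]
      calc p * |b i| + q * |c i| ≤ p * a i + q * a i := by gcongr <;> simp [hb, hc]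
        _ = a i := by rw [← add_mul, hpq, one_mul]
    · simpa [add_smul, mul_smul] using (hy.const_smul p).add (hz.const_smul q)
  · exact ⟨0, fun i => by simpa using (ha i).le, by simpa using hasSum_zero⟩
  · rw [eq_top_iff]
    intro y _
    obtain ⟨b, hb, -⟩ := hbasis y
    refine mem_closure_of_tendsto hb (Eventually.of_forall fun s => ?_)
    refine Submodule.sum_mem _ fun i _ => ?_
    have h1 : a i • e i ∈ Submodule.span ℝ {y : X | ∃ b : ℕ → ℝ, (∀ i, |b i| ≤ a i) ∧
          HasSum (fun i => b i • e i) y} := by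
      refine Submodule.subset_span ⟨Pi.single i (a i), fun j => ?_, ?_⟩
      · by_cases h : j = i
        · subst h; simp [abs_of_pos (ha j)]
        · simpa [h] using (ha j).le
      · have := hasSum_single (f := fun j => (Pi.single i (a i) : ℕ → ℝ) j • e j) i
          (fun j hj => by simp [hj])
        simpa using this
    have h2 : b i • e i = (b i / a i) • a i • e i := by
      rw [smul_smul, div_mul_cancel₀ _ (ha i).ne']
    rw [h2]
    exact Submodule.smul_mem _ _ h1
  · choose B hB hU using hbasis
    simp only at hB hU
    have hs : ∀ y, Summable (fun i => (max (-(a i)) (min (B y i) (a i))) • e i) := fun y =>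
      aux_summable e (B y) _ (fun i => (aux_trunc (a i) (ha i) (B y i) 0).2.1) (hB y).summable
    refine ⟨⟨2 * C, by positivity⟩,
      fun y => ∑' i, (max (-(a i)) (min (B y i) (a i))) • e i, ?_, ?_, ?_, ?_⟩
    · refine LipschitzWith.of_dist_le_mul fun y z => ?_
      rw [dist_eq_norm, dist_eq_norm]
      have h1 := ((hs y).hasSum.sub (hs z).hasSum)
      have h2 : HasSum (fun i => (B y i - B z i) • e i) (y - z) := by
        simpa [sub_smul] using (hB y).sub (hB z)
      refine le_of_tendsto h1.norm (Eventually.of_forall fun s => ?_)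
      have := aux_two e (fun i => B y i - B z i)
        (fun i => max (-(a i)) (min (B y i) (a i)) - max (-(a i)) (min (B z i) (a i)))
        (fun i => (aux_trunc (a i) (ha i) (B y i) (B z i)).2.2.2) (C * ‖y - z‖) s
        (fun u _ => hC _ _ h2 u)
      simp only [sub_smul] at this
      refine this.trans (le_of_eq ?_)
      exact (mul_assoc (2 : ℝ) C _).symm
    · exact fun y => ⟨_, fun i => (aux_trunc (a i) (ha i) (B y i) 0).1, (hs y).hasSum⟩
    · rintro y ⟨b, hb, hy⟩
      have := hU y b hy
      subst this
      refine Eq.trans (tsum_congr fun i => ?_) hy.tsum_eq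
      rw [(aux_trunc (a i) (ha i) (B y i) 0).2.2.1 (hb i)]
    · intro y b hb
      rw [hU y b hb]
      exact (hs y).hasSum

end
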